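/- Let p, q be positive integers with p ≠ q such that q ≥ 97·|p − q| and, in the case p > q, additionally q > 74·(p − q)³. Then there is no positive integer t satisfying Q_{p,q}(t) = 0 together with the four cuboid inequalities t > p², t > p·q, t > q², and (p² + t)(p·q + t) > 2t². In particular, no perfect cuboid arises from parameters (p, q) in the strip q − q/97 ≤ p ≤ q + min(q/97, (q/74)^{1/3}) of the linear region. -/

import Mathlib

/-- The cuboid characteristic polynomial `Q_{p,q}(t)`. -/
def cuboidQ {R : Type*} [CommRing R] (p q t : R) : R :=
  t ^ 10 + (2 * q ^ 2 + p ^ 2) * (3 * q ^ 2 - 2 * p ^ 2) * t ^ 8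
    + (q ^ 8 + 10 * p ^ 2 * q ^ 6 + 4 * p ^ 4 * q ^ 4 - 14 * p ^ 6 * q ^ 2 + p ^ 8) * t ^ 6
    - p ^ 2 * q ^ 2 * (q ^ 8 - 14 * p ^ 2 * q ^ 6 + 4 * p ^ 4 * q ^ 4 + 10 * p ^ 6 * q ^ 2 + p ^ 8) * t ^ 4
    - p ^ 6 * q ^ 6 * (q ^ 2 + 2 * p ^ 2) * (3 * p ^ 2 - 2 * q ^ 2) * t ^ 2
    - p ^ 10 * q ^ 10

/-- The quintic (one sign change) increases after division by `u ^ 3`. -/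
lemma quintic_mono (A B C D E u v : ℝ) (hA : 0 < A) (hC : 0 < C) (hD : 0 < D)
    (hE : 0 < E) (hu : 0 < u) (huv : u ≤ v) :
    (u ^ 5 + A * u ^ 4 + B * u ^ 3 - C * u ^ 2 - D * u - E) * v ^ 3 ≤
    (v ^ 5 + A * v ^ 4 + B * v ^ 3 - C * v ^ 2 - D * v - E) * u ^ 3 := by
  obtain ⟨w, rfl⟩ : ∃ w, v = u + w := ⟨v - u, by ring⟩
  have hw : 0 ≤ w := by linarith
  rw [← sub_nonneg]
  have : ((u + w) ^ 5 + A * (u + w) ^ 4 + B * (u + w) ^ 3 - C * (u + w) ^ 2 - D * (u + w) - E)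
      * u ^ 3 - (u ^ 5 + A * u ^ 4 + B * u ^ 3 - C * u ^ 2 - D * u - E) * (u + w) ^ 3
      = u ^ 3 * (u + w) ^ 3 * (w * (2 * u + w)) + A * (u ^ 3 * (u + w) ^ 3 * w)
        + C * (u ^ 2 * (u + w) ^ 2 * w) + D * (u * (u + w) * (w * (2 * u + w)))
        + E * (w * ((u + w) ^ 2 + (u + w) * u + u ^ 2)) := by ring
  rw [this]
  positivity

lemma cuboidQ_mono (p q x y : ℝ) (hx : 0 < x) (hxy : x ≤ y) (hp : 0 < p) (hq : 0 < q)
    (hA : 0 < 3 * q ^ 2 - 2 * p ^ 2)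
    (hC : 0 < q ^ 8 - 14 * p ^ 2 * q ^ 6 + 4 * p ^ 4 * q ^ 4 + 10 * p ^ 6 * q ^ 2 + p ^ 8)
    (hD : 0 < 3 * p ^ 2 - 2 * q ^ 2) :
    cuboidQ p q x * y ^ 6 ≤ cuboidQ p q y * x ^ 6 := by
  have h := quintic_mono ((2 * q ^ 2 + p ^ 2) * (3 * q ^ 2 - 2 * p ^ 2))
    (q ^ 8 + 10 * p ^ 2 * q ^ 6 + 4 * p ^ 4 * q ^ 4 - 14 * p ^ 6 * q ^ 2 + p ^ 8)
    (p ^ 2 * q ^ 2 * (q ^ 8 - 14 * p ^ 2 * q ^ 6 + 4 * p ^ 4 * q ^ 4 + 10 * p ^ 6 * q ^ 2 + p ^ 8))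
    (p ^ 6 * q ^ 6 * (q ^ 2 + 2 * p ^ 2) * (3 * p ^ 2 - 2 * q ^ 2)) (p ^ 10 * q ^ 10)
    (x ^ 2) (y ^ 2) (by positivity) (by positivity) (by positivity) (by positivity)
    (by positivity) (by gcongr)
  unfold cuboidQ
  convert h using 1 <;> ring

lemma cuboidQ_scale (d p q t : ℝ) :
    cuboidQ (d * p) (d * q) (d ^ 2 * t) = d ^ 20 * cuboidQ p q t := by
  unfold cuboidQ; ring

lemma neg_case (r x : ℝ) (hr : 97 ≤ r) (hx : r ^ 2 < x) : cuboidQ (r - 1) r x ≠ 0 := by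
  obtain ⟨b, rfl⟩ : ∃ b, r = 97 + b := ⟨r - 97, by ring⟩
  have hb : 0 ≤ b := by linarith
  have h := cuboidQ_mono (97 + b - 1) (97 + b) ((97 + b) ^ 2) x (by positivity) hx.le
    (by linarith) (by positivity) (by ring_nf; positivity) (by ring_nf; positivity)
    (by ring_nf; positivity)
  have h0 : 0 < cuboidQ (97 + b - 1) (97 + b) ((97 + b) ^ 2) := by
    unfold cuboidQ; ring_nf; positivity
  have hx0 : 0 < x := lt_trans (by positivity) hx
  intro h1
  rw [h1, zero_mul] at h
  have : 0 < cuboidQ (97 + b - 1) (97 + b) ((97 + b) ^ 2) * x ^ 6 := by positivity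
  linarith

lemma pos_upper (r x : ℝ) (hr : 97 ≤ r) (hx : r ^ 2 + 5 * r + 10 ≤ x) :
    cuboidQ (r + 1) r x ≠ 0 := by
  obtain ⟨b, rfl⟩ : ∃ b, r = 97 + b := ⟨r - 97, by ring⟩
  have hb : 0 ≤ b := by linarith
  have h := cuboidQ_mono (97 + b + 1) (97 + b) ((97 + b) ^ 2 + 5 * (97 + b) + 10) x
    (by positivity) hx
    (by linarith) (by positivity) (by ring_nf; positivity) (by ring_nf; positivity)
    (by ring_nf; positivity)
  have h0 : 0 < cuboidQ (97 + b + 1) (97 + b) ((97 + b) ^ 2 + 5 * (97 + b) + 10) := by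
    unfold cuboidQ; ring_nf; positivity
  have hx0 : 0 < x := lt_of_lt_of_le (by positivity) hx
  intro h1
  rw [h1, zero_mul] at h
  have : 0 < cuboidQ (97 + b + 1) (97 + b) ((97 + b) ^ 2 + 5 * (97 + b) + 10) * x ^ 6 := by
    positivity
  linarith

lemma pos_lower (r x : ℝ) (hr : 97 ≤ r) (hx0 : 0 < x)
    (hx : r * x ≤ r ^ 3 + 5 * r ^ 2 + 10 * r - 74) :
    cuboidQ (r + 1) r x ≠ 0 := by
  obtain ⟨b, rfl⟩ : ∃ b, r = 97 + b := ⟨r - 97, by ring⟩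
  have hb : 0 ≤ b := by linarith
  set r : ℝ := 97 + b with hrdef
  have hr0 : 0 < r := by positivity
  intro h1
  have h2 : cuboidQ (r * (r + 1)) (r * r) (r ^ 2 * x) = 0 := by
    rw [cuboidQ_scale, h1, mul_zero]
  have hle : r ^ 2 * x ≤ r * (r ^ 3 + 5 * r ^ 2 + 10 * r - 74) := by
    have := mul_le_mul_of_nonneg_left hx hr0.le
    linarith
  have h := cuboidQ_mono (r * (r + 1)) (r * r) (r ^ 2 * x)
    (r * (r ^ 3 + 5 * r ^ 2 + 10 * r - 74)) (by positivity) hle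
    (by positivity) (by positivity) (by rw [hrdef]; ring_nf; positivity)
    (by rw [hrdef]; ring_nf; positivity)
    (by rw [hrdef]; ring_nf; positivity)
  have h0 : 0 < -cuboidQ (r * (r + 1)) (r * r) (r * (r ^ 3 + 5 * r ^ 2 + 10 * r - 74)) := by
    unfold cuboidQ; rw [hrdef]; ring_nf; positivity
  rw [h2, zero_mul] at h
  have : 0 < -cuboidQ (r * (r + 1)) (r * r) (r * (r ^ 3 + 5 * r ^ 2 + 10 * r - 74))
      * (r ^ 2 * x) ^ 6 := by positivity
  linarith

/-- Let `p ≠ q` be positive integers with `q ≥ 97|p − q|` and, in case `p > q`,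
additionally `q > 74(p − q)³`.  Then no positive integer `t` satisfies
`Q_{p,q}(t) = 0` together with the four cuboid inequalities; hence no perfect cuboid
arises from such parameters. -/
theorem stmt_16 (p q : ℤ) (hp : 0 < p) (hq : 0 < q) (hne : p ≠ q)
    (h1 : 97 * |p - q| ≤ q) (h2 : q < p → 74 * (p - q) ^ 3 < q) :
    ¬ ∃ t : ℤ, 0 < t ∧ cuboidQ p q t = 0 ∧
      p ^ 2 < t ∧ p * q < t ∧ q ^ 2 < t ∧ 2 * t ^ 2 < (p ^ 2 + t) * (p * q + t) := by
  rintro ⟨t, ht, hQ, -, -, hqt, -⟩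
  have hQR : cuboidQ (p : ℝ) (q : ℝ) (t : ℝ) = 0 := by
    have := congrArg (Int.cast : ℤ → ℝ) hQ
    simp only [cuboidQ] at this ⊢
    push_cast at this
    exact this
  have hqt' : (q : ℝ) ^ 2 < t := by exact_mod_cast hqt
  have ht' : (0 : ℝ) < t := by exact_mod_cast ht
  rcases lt_or_gt_of_ne hne with hlt | hgt
  · obtain ⟨d, rfl⟩ : ∃ d, p = q - d := ⟨q - p, by ring⟩
    have hd : 0 < d := by linarith
    rw [abs_of_neg (by linarith)] at h1
    have hdR : (0 : ℝ) < d := by exact_mod_cast hd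
    have h1R : 97 * (d : ℝ) ≤ q := by
      have : 97 * d ≤ q := by linarith
      exact_mod_cast this
    refine neg_case (q / d) (t / d ^ 2) (by rwa [le_div_iff₀ hdR]) ?_ ?_
    · rw [div_pow]; gcongr
    · have hs := cuboidQ_scale d ((q : ℝ) / d - 1) (q / d) (t / d ^ 2)
      have e1 : (d : ℝ) * ((q : ℝ) / d - 1) = ((q - d : ℤ) : ℝ) := by push_cast; field_simp
      have e2 : (d : ℝ) * ((q : ℝ) / d) = q := by field_simp
      have e3 : (d : ℝ) ^ 2 * ((t : ℝ) / d ^ 2) = t := by field_simp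
      rw [e1, e2, e3, hQR] at hs
      have : (d : ℝ) ^ 20 ≠ 0 := by positivity
      simpa [hdR.ne'] using hs
  · obtain ⟨d, rfl⟩ : ∃ d, p = q + d := ⟨p - q, by ring⟩
    have hd : 0 < d := by linarith
    rw [abs_of_pos (by linarith)] at h1
    have h3 := h2 hgt
    rw [add_sub_cancel_left] at h1 h3
    have hdR : (0 : ℝ) < d := by exact_mod_cast hd
    have hqR : (0 : ℝ) < q := by exact_mod_cast hq
    have h1R : 97 * (d : ℝ) ≤ q := by exact_mod_cast h1
    have h3R : 74 * (d : ℝ) ^ 3 < q := by exact_mod_cast h3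
    have hr : (97 : ℝ) ≤ q / d := by rwa [le_div_iff₀ hdR]
    have hz : cuboidQ ((q : ℝ) / d + 1) (q / d) (t / d ^ 2) = 0 := by
      have hs := cuboidQ_scale d ((q : ℝ) / d + 1) (q / d) (t / d ^ 2)
      have e1 : (d : ℝ) * ((q : ℝ) / d + 1) = ((q + d : ℤ) : ℝ) := by push_cast; field_simp
      have e2 : (d : ℝ) * ((q : ℝ) / d) = q := by field_simp
      have e3 : (d : ℝ) ^ 2 * ((t : ℝ) / d ^ 2) = t := by field_simp
      rw [e1, e2, e3, hQR] at hs
      simpa [hdR.ne'] using hs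
    rcases le_or_gt (q ^ 2 + 5 * q * d + 10 * d ^ 2) t with hT | hT
    · have hTR : (q : ℝ) ^ 2 + 5 * q * d + 10 * d ^ 2 ≤ t := by exact_mod_cast hT
      refine pos_upper _ _ hr ?_ hz
      rw [le_div_iff₀ (by positivity)]
      have : ((q / d : ℝ) ^ 2 + 5 * (q / d) + 10) * d ^ 2
        = (q : ℝ) ^ 2 + 5 * q * d + 10 * d ^ 2 := by field_simp
      linarith
    · have hTR : (t : ℝ) + 1 ≤ (q : ℝ) ^ 2 + 5 * q * d + 10 * d ^ 2 := by exact_mod_cast hT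
      refine pos_lower _ _ hr (by positivity) ?_ hz
      have e4 : (q / d : ℝ) * (t / d ^ 2) = q * t / d ^ 3 := by field_simp
      rw [e4, div_le_iff₀ (by positivity)]
      have : ((q / d : ℝ) ^ 3 + 5 * (q / d) ^ 2 + 10 * (q / d) - 74) * d ^ 3
        = (q : ℝ) * (q ^ 2 + 5 * q * d + 10 * d ^ 2) - 74 * d ^ 3 := by field_simp
      rw [this]
      have := mul_le_mul_of_nonneg_left hTR hqR.le
      linarith
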